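/- In a metric space with antipodes of diameter Δ, the configuration consisting of k copies of the antipode of the current request maximizes the increase of the work function: for every k-server instance, every 1 ≤ t ≤ T, and every configuration X ∈ Ω^k, w_t(X) − w_{t−1}(X) ≤ w_t(r̄_t^k) − w_{t−1}(r̄_t^k), where r̄_t is the antipode of the request r_t and r̄_t^k is the configuration of k copies of r̄_t. -/

import Mathlib

open Finset

/-- Minimum-matching (Wasserstein) distance between two `k`-point configurations,
represented as `k`-tuples of points. -/
noncomputable def confDist {Ω : Type*} [MetricSpace Ω] {k : ℕ} (X Y : Fin k → Ω) : ℝ :=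
  ⨅ σ : Equiv.Perm (Fin k), ∑ i, dist (X i) (Y (σ i))

/-- The work function at time `t` of the `k`-server instance with initial configuration
`X₀` and requests `r 1, r 2, …` (the value `r 0` is unused): the least cost of serving
the first `t` requests and then moving to the configuration `X`. -/
noncomputable def workFn {Ω : Type*} [MetricSpace Ω] (k : ℕ) (X₀ : Fin k → Ω)
    (r : ℕ → Ω) (t : ℕ) (X : Fin k → Ω) : ℝ :=
  sInf { c : ℝ | ∃ Y : ℕ → Fin k → Ω, Y 0 = X₀ ∧
    (∀ i ∈ Finset.Icc 1 t, ∃ j, Y i j = r i) ∧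
    c = (∑ i ∈ Finset.Icc 1 t, confDist (Y (i - 1)) (Y i)) + confDist (Y t) X }

/-- The offline optimum of the `k`-server instance with initial configuration `X₀`
and requests `r 1, …, r T`. -/
noncomputable def opt {Ω : Type*} [MetricSpace Ω] (k : ℕ) (X₀ : Fin k → Ω)
    (r : ℕ → Ω) (T : ℕ) : ℝ :=
  sInf { c : ℝ | ∃ Y : ℕ → Fin k → Ω, Y 0 = X₀ ∧
    (∀ i ∈ Finset.Icc 1 T, ∃ j, Y i j = r i) ∧
    c = ∑ i ∈ Finset.Icc 1 T, confDist (Y (i - 1)) (Y i) }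

/-- `OPT_t(Z)`: the least cost of serving the first `t` requests while ending
in the configuration `Z`. -/
noncomputable def optTo {Ω : Type*} [MetricSpace Ω] (k : ℕ) (X₀ : Fin k → Ω)
    (r : ℕ → Ω) (t : ℕ) (Z : Fin k → Ω) : ℝ :=
  sInf { c : ℝ | ∃ Y : ℕ → Fin k → Ω, Y 0 = X₀ ∧
    (∀ i ∈ Finset.Icc 1 t, ∃ j, Y i j = r i) ∧ Y t = Z ∧
    c = ∑ i ∈ Finset.Icc 1 t, confDist (Y (i - 1)) (Y i) }

/-- `X 0, X 1, …, X T` is a run of the work function algorithm on the `k`-server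
instance with initial configuration `X₀` and requests `r 1, …, r T`. -/
def IsWFARun {Ω : Type*} [MetricSpace Ω] (k : ℕ) (X₀ : Fin k → Ω)
    (r : ℕ → Ω) (T : ℕ) (X : ℕ → Fin k → Ω) : Prop :=
  X 0 = X₀ ∧ ∀ t, 1 ≤ t → t ≤ T →
    (∃ j, X t j = r t) ∧
    ∀ Z : Fin k → Ω, (∃ j, Z j = r t) →
      optTo k X₀ r t (X t) + confDist (X t) (X (t - 1)) ≤
        optTo k X₀ r t Z + confDist Z (X (t - 1))

theorem confDist_le {Ω : Type*} [MetricSpace Ω] {k : ℕ} (X Y : Fin k → Ω)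
    (σ : Equiv.Perm (Fin k)) : confDist X Y ≤ ∑ i, dist (X i) (Y (σ i)) :=
  ciInf_le (Set.finite_range _).bddBelow σ

theorem exists_confDist_eq {Ω : Type*} [MetricSpace Ω] {k : ℕ} (X Y : Fin k → Ω) :
    ∃ σ : Equiv.Perm (Fin k), ∑ i, dist (X i) (Y (σ i)) = confDist X Y :=
  exists_eq_ciInf_of_finite

theorem confDist_nonneg {Ω : Type*} [MetricSpace Ω] {k : ℕ} (X Y : Fin k → Ω) :
    0 ≤ confDist X Y :=
  Real.iInf_nonneg fun _ => Finset.sum_nonneg fun _ _ => dist_nonneg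

theorem confDist_le_add_sum {Ω : Type*} [MetricSpace Ω] {k : ℕ} (X Y Z : Fin k → Ω) :
    confDist X Z ≤ confDist X Y + ∑ i, dist (Y i) (Z i) := by
  obtain ⟨σ, hσ⟩ := exists_confDist_eq X Y
  rw [← hσ, ← Equiv.sum_comp σ fun i => dist (Y i) (Z i), ← Finset.sum_add_distrib]
  exact (confDist_le X Z σ).trans (Finset.sum_le_sum fun _ _ => dist_triangle _ _ _)

theorem confDist_comp_perm_le {Ω : Type*} [MetricSpace Ω] {k : ℕ} (X Y : Fin k → Ω)
    (τ : Equiv.Perm (Fin k)) : confDist X (Y ∘ τ) ≤ confDist X Y := by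
  obtain ⟨σ, hσ⟩ := exists_confDist_eq X Y
  rw [← hσ]
  simpa using confDist_le X (Y ∘ τ) (σ.trans τ.symm)

/-- The first `t` requests can be served, ending in the configuration `X`, at cost at most `c`. -/
def Servable {Ω : Type*} [MetricSpace Ω] {k : ℕ} (X₀ : Fin k → Ω) (r : ℕ → Ω) (t : ℕ)
    (X : Fin k → Ω) (c : ℝ) : Prop :=
  ∃ Y : ℕ → Fin k → Ω, Y 0 = X₀ ∧ (∀ i ∈ Finset.Icc 1 t, ∃ j, Y i j = r i) ∧
    (∑ i ∈ Finset.Icc 1 t, confDist (Y (i - 1)) (Y i)) + confDist (Y t) X ≤ c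

section Servable

variable {Ω : Type*} [MetricSpace Ω] {k : ℕ} {X₀ : Fin k → Ω} {r : ℕ → Ω} {t : ℕ}

theorem Servable.workFn_le {X : Fin k → Ω} {c : ℝ} (h : Servable X₀ r t X c) :
    workFn k X₀ r t X ≤ c := by
  obtain ⟨Y, h0, hr, hc⟩ := h
  refine le_trans (csInf_le ⟨0, ?_⟩ ⟨Y, h0, hr, rfl⟩) hc
  rintro _ ⟨Y, -, -, rfl⟩
  exact add_nonneg (Finset.sum_nonneg fun _ _ => confDist_nonneg _ _) (confDist_nonneg _ _)

theorem servable_workFn_add (hk : 1 ≤ k) (X₀ : Fin k → Ω) (r : ℕ → Ω) (t : ℕ) (X : Fin k → Ω)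
    {ε : ℝ} (hε : 0 < ε) : Servable X₀ r t X (workFn k X₀ r t X + ε) := by
  have hne : { c : ℝ | ∃ Y : ℕ → Fin k → Ω, Y 0 = X₀ ∧
      (∀ i ∈ Finset.Icc 1 t, ∃ j, Y i j = r i) ∧
      c = (∑ i ∈ Finset.Icc 1 t, confDist (Y (i - 1)) (Y i)) + confDist (Y t) X }.Nonempty := by
    refine ⟨_, fun i => if i = 0 then X₀ else fun _ => r i, by simp, fun i hi => ⟨⟨0, hk⟩, ?_⟩, rfl⟩
    have := (Finset.mem_Icc.1 hi).1
    simp [show i ≠ 0 by omega]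
  obtain ⟨_, ⟨Y, h0, hr, rfl⟩, hlt⟩ := Real.lt_sInf_add_pos hne hε
  exact ⟨Y, h0, hr, hlt.le⟩

theorem Servable.move {X X' : Fin k → Ω} {c : ℝ} (h : Servable X₀ r t X c) :
    Servable X₀ r t X' (c + ∑ i, dist (X i) (X' i)) := by
  obtain ⟨Y, h0, hr, hc⟩ := h
  exact ⟨Y, h0, hr, by linarith [confDist_le_add_sum (Y t) X X']⟩

theorem Servable.comp_perm {X : Fin k → Ω} {c : ℝ} (h : Servable X₀ r t X c)
    (τ : Equiv.Perm (Fin k)) : Servable X₀ r t (X ∘ τ) c := by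
  obtain ⟨Y, h0, hr, hc⟩ := h
  exact ⟨Y, h0, hr, by linarith [confDist_comp_perm_le (Y t) X τ]⟩

theorem servable_zero_iff {X : Fin k → Ω} {c : ℝ} :
    Servable X₀ r 0 X c ↔ confDist X₀ X ≤ c := by
  constructor
  · rintro ⟨Y, rfl, -, hc⟩
    simpa using hc
  · exact fun h => ⟨fun _ => X₀, rfl, by simp, by simpa using h⟩

theorem Servable.succ {Z : Fin k → Ω} {c : ℝ} (h : Servable X₀ r t Z c)
    (hZ : ∃ j, Z j = r (t + 1)) : Servable X₀ r (t + 1) Z c := by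
  obtain ⟨Y, h0, hr, hc⟩ := h
  have hZZ : confDist Z Z ≤ 0 := by simpa using confDist_le Z Z 1
  refine ⟨fun i => if i ≤ t then Y i else Z, by simpa using h0, fun i hi => ?_, ?_⟩
  · rw [Finset.mem_Icc] at hi
    by_cases hit : i ≤ t
    · simpa [hit] using hr i (Finset.mem_Icc.2 ⟨hi.1, hit⟩)
    · obtain rfl : i = t + 1 := by omega
      simpa using hZ
  · rw [Finset.sum_Icc_succ_top (by omega)]
    have hsum : ∑ i ∈ Finset.Icc 1 t, confDist (if i - 1 ≤ t then Y (i - 1) else Z)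
        (if i ≤ t then Y i else Z) = ∑ i ∈ Finset.Icc 1 t, confDist (Y (i - 1)) (Y i) := by
      refine Finset.sum_congr rfl fun i hi => ?_
      rw [Finset.mem_Icc] at hi
      rw [if_pos (by omega), if_pos hi.2]
    rw [hsum]
    simp only [add_tsub_cancel_right, le_refl, if_true, show ¬ t + 1 ≤ t by omega, if_false]
    linarith

/-- A schedule for `t + 1` requests passes through a configuration covering the last request,
which may be indexed along an optimal matching with the final configuration. -/
theorem Servable.exists_of_succ {X : Fin k → Ω} {c : ℝ} (h : Servable X₀ r (t + 1) X c) :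
    ∃ (Z : Fin k → Ω) (c' : ℝ), (∃ j, Z j = r (t + 1)) ∧ Servable X₀ r t Z c' ∧
      c' + ∑ i, dist (Z i) (X i) ≤ c := by
  obtain ⟨Y, h0, hr, hc⟩ := h
  rw [Finset.sum_Icc_succ_top (by omega), add_tsub_cancel_right] at hc
  obtain ⟨σ, hσ⟩ := exists_confDist_eq (Y (t + 1)) X
  obtain ⟨j, hj⟩ := hr (t + 1) (Finset.mem_Icc.2 ⟨by omega, le_rfl⟩)
  have hY : Servable X₀ r t (Y (t + 1)) _ :=
    ⟨Y, h0, fun i hi => hr i (Finset.Icc_subset_Icc_right (by omega) hi), le_rfl⟩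
  refine ⟨Y (t + 1) ∘ σ.symm, _, ⟨σ j, by simpa using hj⟩, hY.comp_perm σ.symm, ?_⟩
  rw [← Equiv.sum_comp σ fun i => dist ((Y (t + 1) ∘ σ.symm) i) (X i)]
  simp only [Function.comp_apply, Equiv.symm_apply_apply]
  rwa [hσ]

theorem sum_dist_ite_add (A B C D : Fin k → Ω) (S : Finset (Fin k)) :
    ∑ i, dist (if i ∈ S then B i else A i) (if i ∈ S then D i else C i) +
      ∑ i, dist (if i ∈ S then A i else B i) (if i ∈ S then C i else D i) =
    ∑ i, dist (A i) (C i) + ∑ i, dist (B i) (D i) := by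
  rw [← Finset.sum_add_distrib, ← Finset.sum_add_distrib]
  refine Finset.sum_congr rfl fun i _ => ?_
  split_ifs
  · exact add_comm _ _
  · rfl

/-- Quasi-convexity of the work function, at the level of schedules: two final configurations
can be matched so that exchanging any set of matched pairs does not increase the total cost. -/
theorem Servable.exists_perm_exchange {A B : Fin k → Ω} {a b : ℝ}
    (hA : Servable X₀ r t A a) (hB : Servable X₀ r t B b) :
    ∃ π : Equiv.Perm (Fin k), ∀ S : Finset (Fin k), ∃ a' b' : ℝ,
      Servable X₀ r t (fun i => if i ∈ S then B (π i) else A i) a' ∧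
      Servable X₀ r t (fun i => if i ∈ S then A i else B (π i)) b' ∧ a' + b' ≤ a + b := by
  induction t generalizing A B a b with
  | zero =>
    rw [servable_zero_iff] at hA hB
    obtain ⟨σ, hσ⟩ := exists_confDist_eq X₀ A
    obtain ⟨τ, hτ⟩ := exists_confDist_eq X₀ B
    refine ⟨σ.symm.trans τ, fun S => ?_⟩
    have hX₀ : Servable X₀ r 0 (X₀ ∘ σ.symm) 0 :=
      (servable_zero_iff.2 (by simpa using confDist_le X₀ X₀ 1)).comp_perm σ.symm
    refine ⟨_, _, hX₀.move, hX₀.move, ?_⟩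
    have key := sum_dist_ite_add (X₀ ∘ σ.symm) (X₀ ∘ σ.symm) A (B ∘ σ.symm.trans τ) S
    rw [← Equiv.sum_comp σ fun i => dist ((X₀ ∘ σ.symm) i) (A i),
      ← Equiv.sum_comp σ fun i => dist ((X₀ ∘ σ.symm) i) ((B ∘ σ.symm.trans τ) i)] at key
    simp only [Function.comp_apply, Equiv.symm_apply_apply, Equiv.trans_apply, ite_self] at key ⊢
    linarith
  | succ t ih =>
    obtain ⟨U, a₁, ⟨p, hp⟩, hU, ha⟩ := hA.exists_of_succ
    obtain ⟨V, b₁, ⟨q', hq'⟩, hV, hb⟩ := hB.exists_of_succ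
    obtain ⟨π, hπ⟩ := ih hU hV
    obtain ⟨q, rfl⟩ := π.surjective q'
    -- Rematch so that the two servers at the current request are paired with each other.
    refine ⟨(Equiv.swap p q).trans π, fun S => ?_⟩
    obtain ⟨a', b', ha', hb', hab⟩ :=
      hπ (Finset.univ.filter fun i => if i = p then q ∈ S else i ∈ S)
    have hU' : Servable X₀ r t
        (fun i => if i ∈ S then V (π (Equiv.swap p q i)) else U i) a' := by
      by_cases hS : q ∈ S
      · convert ha'.comp_perm (Equiv.swap p q) using 1
        funext i
        have := Equiv.swap_apply_def p q i
        simp only [Finset.mem_filter, Finset.mem_univ, true_and, Function.comp_apply]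
        grind
      · convert ha' using 1
        funext i
        have := Equiv.swap_apply_def p q i
        simp only [Finset.mem_filter, Finset.mem_univ, true_and]
        grind
    have hV' : Servable X₀ r t
        (fun i => if i ∈ S then U i else V (π (Equiv.swap p q i))) b' := by
      by_cases hS : q ∈ S
      · convert hb' using 1
        funext i
        have := Equiv.swap_apply_def p q i
        simp only [Finset.mem_filter, Finset.mem_univ, true_and]
        grind
      · convert hb'.comp_perm (Equiv.swap p q) using 1
        funext i
        have := Equiv.swap_apply_def p q i
        simp only [Finset.mem_filter, Finset.mem_univ, true_and, Function.comp_apply]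
        grind
    refine ⟨_, _, (hU'.succ ⟨p, by simp [hp, hq']⟩).move,
      (hV'.succ ⟨p, by simp [hp, hq']⟩).move, ?_⟩
    have key := sum_dist_ite_add U (fun i => V (π (Equiv.swap p q i))) A
      (fun i => B (π (Equiv.swap p q i))) S
    have hVB := Equiv.sum_comp ((Equiv.swap p q).trans π) fun i => dist (V i) (B i)
    simp only [Equiv.trans_apply] at hVB ⊢
    linarith

end Servable

/-- In a metric space with antipodes of diameter `Δ`, the configuration of `k` copies
of the antipode of the current request maximizes the increase of the work function. -/
theorem workFn_increase_max_at_antipode {Ω : Type*} [MetricSpace Ω]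
    (Δ : ℝ) (bar : Ω → Ω) (hbar : ∀ x y : Ω, dist x y + dist y (bar x) = Δ)
    (k : ℕ) (hk : 1 ≤ k) (X₀ : Fin k → Ω) (r : ℕ → Ω) (T t : ℕ)
    (ht : 1 ≤ t) (htT : t ≤ T) (X : Fin k → Ω) :
    workFn k X₀ r t X - workFn k X₀ r (t - 1) X ≤
      workFn k X₀ r t (fun _ => bar (r t)) -
        workFn k X₀ r (t - 1) (fun _ => bar (r t)) := by
  obtain ⟨s, rfl⟩ : ∃ s, t = s + 1 := ⟨t - 1, by omega⟩
  rw [add_tsub_cancel_right]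
  refine le_of_forall_pos_le_add fun ε hε => ?_
  have hX := servable_workFn_add hk X₀ r s X (half_pos hε)
  obtain ⟨Z, c, ⟨j, hj⟩, hZ, hc⟩ :=
    (servable_workFn_add hk X₀ r (s + 1) (fun _ => bar (r (s + 1))) (half_pos hε)).exists_of_succ
  obtain ⟨π, hπ⟩ := hX.exists_perm_exchange hZ
  obtain ⟨i₀, rfl⟩ := π.surjective j
  obtain ⟨a, b, ha, hb, hab⟩ := hπ {i₀}
  have h₁ := ((ha.succ ⟨i₀, by simpa using hj⟩).move (X' := X)).workFn_le
  have h₂ := (hb.move (X' := fun _ => bar (r (s + 1)))).workFn_le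
  rw [← Equiv.sum_comp π] at hc
  have e₁ : ∑ i, dist (if i ∈ ({i₀} : Finset (Fin k)) then Z (π i) else X i) (X i) =
      dist (r (s + 1)) (X i₀) := by
    rw [Finset.sum_eq_single i₀ (fun i _ hi => by simp [hi]) (by simp)]
    simp [hj]
  have e₂ : ∑ i, dist (if i ∈ ({i₀} : Finset (Fin k)) then X i else Z (π i)) (bar (r (s + 1))) +
      dist (r (s + 1)) (bar (r (s + 1))) =
      ∑ i, dist (Z (π i)) (bar (r (s + 1))) + dist (X i₀) (bar (r (s + 1))) := by
    rw [← Finset.add_sum_erase _ _ (Finset.mem_univ i₀),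
      ← Finset.add_sum_erase _ (fun i => dist (Z (π i)) (bar (r (s + 1)))) (Finset.mem_univ i₀),
      Finset.sum_congr rfl fun i hi => by
        rw [if_neg (by simpa using Finset.ne_of_mem_erase hi)]]
    simp only [Finset.mem_singleton, if_true, hj]
    ring
  have hΔ := hbar (r (s + 1)) (X i₀)
  have hΔ' := hbar (r (s + 1)) (r (s + 1))
  rw [dist_self, zero_add] at hΔ'
  linarith
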